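/- Let ν ∈ (0,1) and m₁, m₂ > 0. Let κ₁, κ₂ : ℝ → ℝ satisfy κᵢ(0) = 0 and κᵢ(u)/u → mᵢ as u → 0 with u ≠ 0 (for i = 1,2). Let a : (0,∞) → (0,∞) satisfy a(t) → 0 and t·a(t) → ∞ as t → ∞. Then for every real θ, lim_{t→∞} a(t) · [ log E_ν( κ₁( θ·(a(t)·t)^{−ν} )·t^ν ) + log E_ν( κ₂( −θ·(a(t)·t)^{−ν} )·t^ν ) ] = Ψ(θ), where Ψ(θ) := (m₁θ)^{1/ν} for θ ≥ 0 and Ψ(θ) := (−m₂θ)^{1/ν} for θ < 0. -/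

import Mathlib

open Filter

noncomputable def mittagLeffler (ν x : ℝ) : ℝ := ∑' k : ℕ, x ^ k / Real.Gamma (ν * k + 1)

noncomputable def PsiMD (ν m₁ m₂ θ : ℝ) : ℝ :=
  if 0 ≤ θ then (m₁ * θ) ^ (1 / ν) else (-m₂ * θ) ^ (1 / ν)

/-- The exponential generating function at `-y` of a moment sequence `m`. -/
noncomputable def laplaceSeries (m : ℕ → ℝ) (y : ℝ) : ℝ :=
  ∑' k : ℕ, (-y) ^ k / k.factorial * m k

theorem norm_laplaceSeries_term_le {m : ℕ → ℝ} (hm : ∀ k, |m k| ≤ 1) {x y : ℝ} (hxy : |x| ≤ y)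
    (k : ℕ) : ‖(-x) ^ k / k.factorial * m k‖ ≤ y ^ k / k.factorial := by
  rw [norm_mul, norm_div, norm_pow, norm_neg, Real.norm_eq_abs, Real.norm_eq_abs, Real.norm_eq_abs,
    Nat.abs_cast]
  calc |x| ^ k / k.factorial * |m k| ≤ |x| ^ k / k.factorial * 1 := by gcongr; exact hm k
    _ ≤ y ^ k / k.factorial := by rw [mul_one]; gcongr

theorem summable_laplaceSeries {m : ℕ → ℝ} (hm : ∀ k, |m k| ≤ 1) (y : ℝ) :
    Summable fun k : ℕ => (-y) ^ k / k.factorial * m k :=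
  (Real.summable_pow_div_factorial |y|).of_norm_bounded
    (norm_laplaceSeries_term_le hm le_rfl)

theorem continuousOn_laplaceSeries {m : ℕ → ℝ} (hm : ∀ k, |m k| ≤ 1) (y : ℝ) :
    ContinuousOn (laplaceSeries m) (Set.Icc (-y) y) :=
  continuousOn_tsum (fun k => by fun_prop) (Real.summable_pow_div_factorial y)
    fun k _ hx => norm_laplaceSeries_term_le hm (abs_le.2 hx) k

theorem continuousOn_laplaceSeries_mul_pow {m : ℕ → ℝ} (hm : ∀ k, |m k| ≤ 1) {y : ℝ}
    (hy : 0 ≤ y) (j : ℕ) :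
    ContinuousOn (fun v => laplaceSeries m (y * v) * ((j + 1) * v ^ j)) (Set.uIcc 0 1) := by
  refine ((continuousOn_laplaceSeries hm y).comp (by fun_prop) ?_).mul (by fun_prop)
  intro v hv
  rw [Set.uIcc_of_le zero_le_one] at hv
  exact ⟨by nlinarith [hv.1, hv.2], by nlinarith [hv.1, hv.2]⟩

theorem hasSum_integral_laplaceSeries {m : ℕ → ℝ} (hm : ∀ k, |m k| ≤ 1) {y : ℝ} (hy : 0 ≤ y)
    (j : ℕ) :
    HasSum (fun k : ℕ => (-y) ^ k / k.factorial * m k * ((j + 1) / (k + j + 1)))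
      (∫ v in (0 : ℝ)..1, laplaceSeries m (y * v) * ((j + 1) * v ^ j)) := by
  have key := intervalIntegral.hasSum_integral_of_dominated_convergence (a := 0) (b := 1)
    (μ := MeasureTheory.volume)
    (F := fun (k : ℕ) (v : ℝ) => (-(y * v)) ^ k / k.factorial * m k * ((j + 1) * v ^ j))
    (f := fun v => laplaceSeries m (y * v) * ((j + 1) * v ^ j))
    (fun (k : ℕ) _ => y ^ k / k.factorial * (j + 1)) ?_ ?_ ?_ ?_ ?_
  · refine key.congr_fun fun k => ?_
    have h : ∀ v : ℝ, (-(y * v)) ^ k / k.factorial * m k * ((j + 1) * v ^ j)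
        = ((-y) ^ k / k.factorial * m k * (j + 1)) * v ^ (k + j) := by
      intro v
      rw [← neg_mul, mul_pow, pow_add]
      ring
    simp_rw [h]
    rw [intervalIntegral.integral_const_mul, integral_pow]
    simp
    ring
  · intro k
    exact (by fun_prop : Continuous _).aestronglyMeasurable
  · intro k
    refine Eventually.of_forall fun v hv => ?_
    rw [Set.uIoc_of_le zero_le_one] at hv
    have h1 := norm_laplaceSeries_term_le hm (x := y * v) (y := y)
      (by rw [abs_of_nonneg (mul_nonneg hy hv.1.le)]; nlinarith [hv.1, hv.2]) k
    have h2 : ‖((j : ℝ) + 1) * v ^ j‖ ≤ j + 1 := by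
      rw [Real.norm_of_nonneg (mul_nonneg (by positivity) (pow_nonneg hv.1.le j))]
      exact mul_le_of_le_one_right (by positivity) (pow_le_one₀ hv.1.le hv.2)
    rw [norm_mul]
    exact mul_le_mul h1 h2 (norm_nonneg _) (by positivity)
  · exact Eventually.of_forall fun v _ => (Real.summable_pow_div_factorial y).mul_right _
  · exact intervalIntegrable_const
  · refine Eventually.of_forall fun v _ => ?_
    exact (summable_laplaceSeries hm (y * v)).hasSum.mul_right _

theorem laplaceSeries_mul_ratio {m : ℕ → ℝ} (hm : ∀ k, |m k| ≤ 1) (ν : ℝ) {y : ℝ} (hy : 0 ≤ y)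
    (j : ℕ) :
    laplaceSeries (fun k => m k * ((1 + ν * k / (j + 1)) / (1 + k / (j + 1)))) y =
      ν * laplaceSeries m y +
        (1 - ν) * ∫ v in (0 : ℝ)..1, laplaceSeries m (y * v) * ((j + 1) * v ^ j) := by
  refine HasSum.tsum_eq ?_
  refine (((summable_laplaceSeries hm y).hasSum.mul_left ν).add
    ((hasSum_integral_laplaceSeries hm hy j).mul_left (1 - ν))).congr_fun fun k => ?_
  have : (k : ℝ) + j + 1 ≠ 0 := by positivity
  have : (1 : ℝ) + k / (j + 1) ≠ 0 := by positivity
  field_simp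
  ring

theorem exp_neg_le_integral_exp_neg_mul_pow (A : ℝ) (j : ℕ) :
    Real.exp (-A * ((j + 1) / (j + 2))) ≤
      ∫ v in (0 : ℝ)..1, Real.exp (-A * v) * ((j + 1) * v ^ j) := by
  set p : ℝ := (j + 1) / (j + 2) with hp
  have h : ∫ v in (0 : ℝ)..1, (Real.exp (-A * p) * (1 - A * (v - p))) * ((j + 1) * v ^ j)
      = Real.exp (-A * p) := by
    have h' : ∀ v : ℝ, (Real.exp (-A * p) * (1 - A * (v - p))) * ((j + 1) * v ^ j) =
        Real.exp (-A * p) * (j + 1) * (1 + A * p) * v ^ j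
          - Real.exp (-A * p) * (j + 1) * A * v ^ (j + 1) := fun v => by ring
    simp_rw [h']
    rw [intervalIntegral.integral_sub (Continuous.intervalIntegrable (by fun_prop) _ _)
      (Continuous.intervalIntegrable (by fun_prop) _ _), intervalIntegral.integral_const_mul,
      intervalIntegral.integral_const_mul, integral_pow, integral_pow]
    have : (j : ℝ) + 2 ≠ 0 := by positivity
    have : (j : ℝ) + 1 + 1 ≠ 0 := by positivity
    generalize Real.exp (-A * p) = E
    rw [hp]
    push_cast
    simp only [one_pow, zero_pow (Nat.succ_ne_zero _), sub_zero]
    field_simp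
    ring
  rw [← h]
  refine intervalIntegral.integral_mono_on zero_le_one
    (Continuous.intervalIntegrable (by fun_prop) _ _)
    (Continuous.intervalIntegrable (by fun_prop) _ _) fun v hv => ?_
  refine mul_le_mul_of_nonneg_right ?_ (mul_nonneg (by positivity) (pow_nonneg hv.1 j))
  have e : Real.exp (-A * v) = Real.exp (-A * p) * Real.exp (-A * (v - p)) := by
    rw [← Real.exp_add]; ring_nf
  rw [e]
  gcongr
  linarith [Real.add_one_le_exp (-A * (v - p))]

theorem laplaceSeries_mul_ratio_bounds {m : ℕ → ℝ} (hm : ∀ k, |m k| ≤ 1) {ν : ℝ}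
    (hν : ν ∈ Set.Icc (0 : ℝ) 1) {b : ℝ}
    (hb : ∀ y, 0 ≤ y → Real.exp (-b * y) ≤ laplaceSeries m y ∧ laplaceSeries m y ≤ 1)
    (j : ℕ) {y : ℝ} (hy : 0 ≤ y) :
    Real.exp (-(b * ((1 + ν / (j + 1)) / (1 + 1 / (j + 1)))) * y) ≤
        laplaceSeries (fun k => m k * ((1 + ν * k / (j + 1)) / (1 + k / (j + 1)))) y ∧
      laplaceSeries (fun k => m k * ((1 + ν * k / (j + 1)) / (1 + k / (j + 1)))) y ≤ 1 := by
  rw [laplaceSeries_mul_ratio hm ν hy j]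
  have hint := (continuousOn_laplaceSeries_mul_pow hm hy j).intervalIntegrable
    (μ := MeasureTheory.volume)
  have hν' : 0 ≤ 1 - ν := sub_nonneg.2 hν.2
  constructor
  · have h1 : Real.exp (-(b * y) * ((j + 1) / (j + 2))) ≤
        ∫ v in (0 : ℝ)..1, laplaceSeries m (y * v) * ((j + 1) * v ^ j) := by
      refine (exp_neg_le_integral_exp_neg_mul_pow (b * y) j).trans ?_
      refine intervalIntegral.integral_mono_on zero_le_one
        (Continuous.intervalIntegrable (by fun_prop) _ _) hint fun v hv => ?_
      refine mul_le_mul_of_nonneg_right ?_ (mul_nonneg (by positivity) (pow_nonneg hv.1 j))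
      simpa only [neg_mul, mul_assoc] using (hb (y * v) (mul_nonneg hy hv.1)).1
    have h2 := convexOn_exp.2 (Set.mem_univ (-b * y))
      (Set.mem_univ (-(b * y) * ((j + 1) / (j + 2)))) hν.1 hν' (by ring)
    simp only [smul_eq_mul] at h2
    have h3 : -(b * ((1 + ν / (j + 1)) / (1 + 1 / (j + 1)))) * y =
        ν * (-b * y) + (1 - ν) * (-(b * y) * ((j + 1) / (j + 2))) := by
      have : (j : ℝ) + 2 ≠ 0 := by positivity
      have : (1 : ℝ) + 1 / (j + 1) = (j + 2) / (j + 1) := by field_simp; ring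
      rw [this]
      field_simp
      ring
    rw [h3]
    refine h2.trans ?_
    gcongr
    exacts [hν.1, (hb y hy).1]
  · have h1 : ∫ v in (0 : ℝ)..1, laplaceSeries m (y * v) * ((j + 1) * v ^ j) ≤ 1 := by
      calc _ ≤ ∫ v in (0 : ℝ)..1, ((j : ℝ) + 1) * v ^ j := by
            refine intervalIntegral.integral_mono_on zero_le_one hint
              (Continuous.intervalIntegrable (by fun_prop) _ _) fun v hv => ?_
            exact mul_le_of_le_one_left (mul_nonneg (by positivity) (pow_nonneg hv.1 j))
              (hb (y * v) (mul_nonneg hy hv.1)).2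
        _ = 1 := by
            rw [intervalIntegral.integral_const_mul, integral_pow]
            simp
            field_simp
    calc _ ≤ ν * 1 + (1 - ν) * 1 := by gcongr; exacts [hν.1, (hb y hy).2]
      _ = 1 := by ring

/-- The finite product `∏_{j ≤ N} (1 + νs/j) / (1 + s/j)`. -/
noncomputable def ratioProd (ν : ℝ) (N : ℕ) (s : ℝ) : ℝ :=
  ∏ j ∈ Finset.range N, (1 + ν * s / (j + 1)) / (1 + s / (j + 1))

theorem ratioProd_nonneg {ν : ℝ} (hν : 0 ≤ ν) (N : ℕ) {s : ℝ} (hs : 0 ≤ s) :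
    0 ≤ ratioProd ν N s :=
  Finset.prod_nonneg fun j _ => by positivity

theorem abs_ratioProd_le_one {ν : ℝ} (hν : ν ∈ Set.Icc (0 : ℝ) 1) (N : ℕ) {s : ℝ} (hs : 0 ≤ s) :
    |ratioProd ν N s| ≤ 1 := by
  have h0 := hν.1
  rw [abs_of_nonneg (ratioProd_nonneg h0 N hs)]
  refine Finset.prod_le_one (fun j _ => by positivity) fun j _ => ?_
  refine div_le_one_of_le₀ ?_ (by positivity)
  gcongr
  exact mul_le_of_le_one_left hs hν.2

theorem laplaceSeries_ratioProd_bounds {ν : ℝ} (hν : ν ∈ Set.Icc (0 : ℝ) 1) (N : ℕ) :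
    ∀ y, 0 ≤ y → Real.exp (-ratioProd ν N 1 * y) ≤ laplaceSeries (fun k => ratioProd ν N k) y ∧
      laplaceSeries (fun k => ratioProd ν N k) y ≤ 1 := by
  induction N with
  | zero =>
    intro y hy
    have h : laplaceSeries (fun k => ratioProd ν 0 k) y = Real.exp (-y) := by
      simp [laplaceSeries, ratioProd, Real.exp_eq_exp_ℝ, NormedSpace.exp_eq_tsum_div]
    rw [h]
    simp [ratioProd, hy]
  | succ N ih =>
    intro y hy
    have h := laplaceSeries_mul_ratio_bounds
      (fun k => abs_ratioProd_le_one hν N (Nat.cast_nonneg k)) hν ih N hy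
    simpa only [ratioProd, Finset.prod_range_succ, mul_one] using h

theorem factorial_floor_div_two_le_Gamma_add_one {s : ℝ} (hs : 0 ≤ s) :
    (⌊s⌋₊.factorial : ℝ) / 2 ≤ Real.Gamma (s + 1) := by
  set n := ⌊s⌋₊ with hn
  have h1 : (n : ℝ) ≤ s := Nat.floor_le hs
  have h2 : s < n + 1 := Nat.lt_floor_add_one s
  have h3 : Real.Gamma ((n + 1 : ℕ) + 1) ≤ Real.Gamma (s + 1 + 1) := by
    refine Real.Gamma_strictMonoOn_Ici.monotoneOn ?_ ?_ ?_
    · simp only [Set.mem_Ici]; push_cast; linarith [(Nat.cast_nonneg n : (0 : ℝ) ≤ n)]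
    · simp only [Set.mem_Ici]; linarith
    · push_cast; linarith
  rw [Real.Gamma_nat_eq_factorial, Real.Gamma_add_one (by positivity), Nat.factorial_succ] at h3
  push_cast at h3
  have h4 : 0 < Real.Gamma (s + 1) := Real.Gamma_pos_of_pos (by positivity)
  have h5 : (s + 1) * Real.Gamma (s + 1) ≤ 2 * (n + 1) * Real.Gamma (s + 1) :=
    mul_le_mul_of_nonneg_right (by linarith [(Nat.cast_nonneg n : (0 : ℝ) ≤ n)]) h4.le
  have h6 : (0 : ℝ) < n + 1 := by positivity
  have h7 : (n + 1 : ℝ) * n.factorial ≤ (n + 1) * (2 * Real.Gamma (s + 1)) := by linarith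
  linarith [le_of_mul_le_mul_left h7 h6]

theorem Gamma_add_one_le_factorial {s : ℝ} {n : ℕ} (hs : 1 ≤ s) (hsn : s ≤ n) :
    Real.Gamma (s + 1) ≤ n.factorial := by
  rw [← Real.Gamma_nat_eq_factorial]
  exact Real.Gamma_strictMonoOn_Ici.monotoneOn (Set.mem_Ici.2 (by linarith))
    (Set.mem_Ici.2 (by linarith)) (by linarith)

theorem rpow_div_Gamma_add_one_le {s w ρ : ℝ} (hs : 0 ≤ s) (hw : 1 ≤ w) (hρ : 1 ≤ ρ) :
    w ^ s / Real.Gamma (s + 1) ≤ 2 * ρ * w * Real.exp (ρ * w) * ρ ^ (-s) := by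
  set n := ⌊s⌋₊ with hn
  have h1 : (n : ℝ) ≤ s := Nat.floor_le hs
  have h2 : s < n + 1 := Nat.lt_floor_add_one s
  have hw0 : 0 < w := by linarith
  have hρ0 : 0 < ρ := by linarith
  have h3 : w ^ s ≤ w ^ n * w := by
    rw [← pow_succ, ← Real.rpow_natCast]
    exact Real.rpow_le_rpow_of_exponent_le hw (by push_cast; exact h2.le)
  have h4 : w ^ n / n.factorial ≤ Real.exp (ρ * w) * ρ ^ (1 - s) := by
    have h := Real.pow_div_factorial_le_exp (ρ * w) (by positivity) n
    have h' : (ρ ^ n)⁻¹ ≤ ρ ^ (1 - s) := by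
      rw [← Real.rpow_natCast, ← Real.rpow_neg hρ0.le]
      exact Real.rpow_le_rpow_of_exponent_le hρ (by linarith)
    calc w ^ n / n.factorial = (ρ * w) ^ n / n.factorial * (ρ ^ n)⁻¹ := by
          rw [mul_pow]; field_simp
      _ ≤ _ := by gcongr
  have h5 : ρ ^ (1 - s) = ρ * ρ ^ (-s) := by
    rw [sub_eq_add_neg, Real.rpow_add hρ0, Real.rpow_one]
  calc w ^ s / Real.Gamma (s + 1) ≤ (w ^ n * w) / (n.factorial / 2) := by
        gcongr
        exact factorial_floor_div_two_le_Gamma_add_one hs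
    _ = 2 * w * (w ^ n / n.factorial) := by field_simp
    _ ≤ 2 * w * (Real.exp (ρ * w) * ρ ^ (1 - s)) := by gcongr
    _ = _ := by rw [h5]; ring

theorem rpow_pow_div_Gamma_le {ν : ℝ} (hν : 0 < ν) {w ρ : ℝ} (hw : 1 ≤ w) (hρ : 1 ≤ ρ) (k : ℕ) :
    (w ^ ν) ^ k / Real.Gamma (ν * k + 1) ≤ 2 * ρ * w * Real.exp (ρ * w) * (ρ ^ (-ν)) ^ k := by
  have h := rpow_div_Gamma_add_one_le (s := ν * k) (by positivity) hw hρ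
  rwa [← neg_mul, Real.rpow_mul (by linarith), Real.rpow_mul (by linarith), Real.rpow_natCast,
    Real.rpow_natCast] at h

theorem Gamma_mul_natCast_add_one_pos {ν : ℝ} (hν : 0 < ν) (k : ℕ) :
    0 < Real.Gamma (ν * k + 1) :=
  Real.Gamma_pos_of_pos (by positivity)

theorem summable_mittagLeffler {ν : ℝ} (hν : 0 < ν) (x : ℝ) :
    Summable fun k : ℕ => x ^ k / Real.Gamma (ν * k + 1) := by
  set w := max 1 (|x| ^ ν⁻¹) with hw
  have h1 : |x| ≤ w ^ ν := by
    calc |x| = (|x| ^ ν⁻¹) ^ ν := by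
          rw [← Real.rpow_mul (abs_nonneg x), inv_mul_cancel₀ hν.ne', Real.rpow_one]
      _ ≤ w ^ ν := by gcongr; exact le_max_right _ _
  have h2 : (2 : ℝ) ^ (-ν) < 1 := Real.rpow_lt_one_of_one_lt_of_neg one_lt_two (by linarith)
  refine Summable.of_norm_bounded
    ((summable_geometric_of_lt_one (by positivity) h2).mul_left
      (2 * 2 * w * Real.exp (2 * w))) fun k => ?_
  refine le_trans ?_ (rpow_pow_div_Gamma_le hν (le_max_left _ _) one_le_two k)
  have h3 := Gamma_mul_natCast_add_one_pos hν k
  rw [norm_div, norm_pow, Real.norm_of_nonneg h3.le, Real.norm_eq_abs]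
  gcongr

theorem mittagLeffler_rpow_le {ν : ℝ} (hν : 0 < ν) {w ρ : ℝ} (hw : 1 ≤ w) (hρ : 1 < ρ) :
    mittagLeffler ν (w ^ ν) ≤ 2 * ρ * (1 - ρ ^ (-ν))⁻¹ * w * Real.exp (ρ * w) := by
  have h2 : ρ ^ (-ν) < 1 := Real.rpow_lt_one_of_one_lt_of_neg hρ (by linarith)
  have h3 := (hasSum_geometric_of_lt_one (by positivity) h2).mul_left
    (2 * ρ * w * Real.exp (ρ * w))
  calc mittagLeffler ν (w ^ ν) ≤ _ := (summable_mittagLeffler hν _).tsum_le_of_sum_le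
        fun s => (Finset.sum_le_sum fun k _ => rpow_pow_div_Gamma_le hν hw hρ.le k).trans
          (h3.summable.sum_le_tsum s fun k _ => by positivity)
    _ = _ := by rw [h3.tsum_eq]; ring

theorem exp_sub_one_div_le_mittagLeffler_rpow {ν : ℝ} (hν : ν ∈ Set.Ioo (0 : ℝ) 1) {w : ℝ}
    (hw : 1 ≤ w) : (Real.exp w - 1) / w ≤ mittagLeffler ν (w ^ ν) := by
  have hν0 := hν.1
  have hw0 : 0 < w := by linarith
  have hlow : ∀ n : ℕ, (n : ℝ) ≤ ν * ⌈n / ν⌉₊ := fun n => by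
    have h := Nat.le_ceil ((n : ℝ) / ν)
    rwa [div_le_iff₀' hν0] at h
  have hup : ∀ n : ℕ, ν * ⌈n / ν⌉₊ < n + 1 := fun n => by
    have h := Nat.ceil_lt_add_one (a := (n : ℝ) / ν) (by positivity)
    calc ν * ⌈n / ν⌉₊ < ν * (n / ν + 1) := by gcongr
      _ = n + ν := by field_simp
      _ < n + 1 := by linarith [hν.2]
  have hinj : Function.Injective fun n : ℕ => ⌈n / ν⌉₊ := by
    refine Function.LeftInverse.injective (g := fun k : ℕ => ⌊ν * k⌋₊) fun n => ?_
    exact (Nat.floor_eq_iff (by positivity)).2 ⟨hlow n, hup n⟩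
  have hsum : HasSum (fun n : ℕ => w ^ n / (n + 1).factorial) ((Real.exp w - 1) / w) := by
    have h1 : HasSum (fun n : ℕ => w ^ n / n.factorial) (Real.exp w) := by
      rw [Real.exp_eq_exp_ℝ]
      exact NormedSpace.expSeries_div_hasSum_exp w
    have h2 := ((hasSum_nat_add_iff' 1).2 h1).div_const w
    simp only [Finset.range_one, Finset.sum_singleton, pow_zero, Nat.factorial_zero, Nat.cast_one,
      div_one] at h2
    refine h2.congr_fun fun n => ?_
    rw [pow_succ]
    field_simp
  rw [← hsum.tsum_eq]
  refine Summable.tsum_le_tsum_of_inj (fun n : ℕ => ⌈n / ν⌉₊) hinj (fun k _ => ?_) (fun n => ?_)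
    hsum.summable (summable_mittagLeffler hν0 _)
  · have := Gamma_mul_natCast_add_one_pos hν0 k
    positivity
  · have hG : Real.Gamma (ν * ⌈n / ν⌉₊ + 1) ≤ (n + 1).factorial := by
      rcases Nat.eq_zero_or_pos n with rfl | hn
      · simp
      · have hn' : (1 : ℝ) ≤ n := by exact_mod_cast hn
        exact Gamma_add_one_le_factorial (hn'.trans (hlow n)) (by push_cast; exact (hup n).le)
    have hp : w ^ n ≤ (w ^ ν) ^ ⌈n / ν⌉₊ := by
      rw [← Real.rpow_natCast (w ^ ν), ← Real.rpow_mul hw0.le, ← Real.rpow_natCast]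
      exact Real.rpow_le_rpow_of_exponent_le hw (hlow n)
    have := Gamma_mul_natCast_add_one_pos hν0 ⌈n / ν⌉₊
    gcongr

theorem tendsto_log_mittagLeffler_rpow_div {ν : ℝ} (hν : ν ∈ Set.Ioo (0 : ℝ) 1) :
    Tendsto (fun w : ℝ => Real.log (mittagLeffler ν (w ^ ν)) / w) atTop (nhds 1) := by
  have hlog : ∀ C : ℝ, 0 < C → Tendsto (fun w : ℝ => Real.log (C * w) / w) atTop (nhds 0) := by
    intro C hC
    have h1 := (Real.isLittleO_log_id_atTop.tendsto_div_nhds_zero).add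
      (tendsto_const_nhds (x := Real.log C).div_atTop tendsto_id)
    rw [add_zero] at h1
    refine h1.congr' ?_
    filter_upwards [eventually_gt_atTop 0] with w hw
    rw [Real.log_mul hC.ne' hw.ne', id, add_comm, ← add_div]
  have hexp : ∀ w : ℝ, 1 ≤ w → Real.exp w / (2 * w) ≤ (Real.exp w - 1) / w := by
    intro w hw
    have := Real.add_one_le_exp w
    rw [div_le_div_iff₀ (by positivity) (by positivity)]
    nlinarith
  rw [tendsto_order]
  constructor
  · intro c hc
    filter_upwards [(hlog 2 two_pos).eventually_lt_const (sub_pos.2 hc), eventually_ge_atTop 1]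
      with w h1 hw
    have hw0 : 0 < w := by linarith
    have h2 : w - Real.log (2 * w) ≤ Real.log (mittagLeffler ν (w ^ ν)) := by
      have h := Real.log_le_log (by positivity)
        ((hexp w hw).trans (exp_sub_one_div_le_mittagLeffler_rpow hν hw))
      rwa [Real.log_div (Real.exp_pos w).ne' (by positivity), Real.log_exp] at h
    rw [lt_div_iff₀ hw0]
    rw [div_lt_iff₀ hw0] at h1
    linarith
  · intro c hc
    obtain ⟨ρ, hρ1, hρc⟩ := exists_between hc
    have hC : 0 < 2 * ρ * (1 - ρ ^ (-ν))⁻¹ := by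
      have : 0 < 1 - ρ ^ (-ν) :=
        sub_pos.2 (Real.rpow_lt_one_of_one_lt_of_neg hρ1 (neg_lt_zero.2 hν.1))
      have : 0 < ρ := by linarith
      positivity
    filter_upwards [(hlog _ hC).eventually_lt_const (sub_pos.2 hρc), eventually_ge_atTop 1]
      with w h1 hw
    have hw0 : 0 < w := by linarith
    have hpos : 0 < mittagLeffler ν (w ^ ν) :=
      (by positivity : 0 < Real.exp w / (2 * w)).trans_le
        ((hexp w hw).trans (exp_sub_one_div_le_mittagLeffler_rpow hν hw))
    have h2 := Real.log_le_log hpos (mittagLeffler_rpow_le hν.1 hw hρ1)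
    rw [Real.log_mul (by positivity) (Real.exp_pos _).ne', Real.log_exp] at h2
    rw [div_lt_iff₀ hw0] at h1 ⊢
    linarith

theorem monotone_exp_harmonic_mul_ratioProd {ν : ℝ} (hν : ν ∈ Set.Icc (0 : ℝ) 1) {s : ℝ}
    (hs : 0 ≤ s) :
    Monotone fun N : ℕ => Real.exp ((1 - ν) * s * harmonic N) * ratioProd ν N s := by
  refine monotone_nat_of_le_succ fun N => ?_
  have h0 := ratioProd_nonneg hν.1 N hs
  set x : ℝ := s / (N + 1) with hx
  have hx0 : 0 ≤ x := by positivity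
  have h1 : 1 ≤ Real.exp ((1 - ν) * x) * ((1 + ν * x) / (1 + x)) := by
    rw [mul_div_assoc', one_le_div (by positivity)]
    have hνx : 0 ≤ ν * x := mul_nonneg hν.1 hx0
    have hνx' : 0 ≤ (1 - ν) * x := mul_nonneg (sub_nonneg.2 hν.2) hx0
    calc 1 + x ≤ ((1 - ν) * x + 1) * (1 + ν * x) := by nlinarith [mul_nonneg hνx hνx']
      _ ≤ _ := by gcongr; exact Real.add_one_le_exp _
  have h2 : Real.exp ((1 - ν) * s * harmonic (N + 1)) =
      Real.exp ((1 - ν) * s * harmonic N) * Real.exp ((1 - ν) * x) := by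
    rw [← Real.exp_add, harmonic_succ, hx]
    push_cast
    ring_nf
  have h3 : ratioProd ν (N + 1) s = ratioProd ν N s * ((1 + ν * x) / (1 + x)) := by
    rw [ratioProd, Finset.prod_range_succ, ← ratioProd, hx, mul_div_assoc]
  rw [h2, h3]
  calc Real.exp ((1 - ν) * s * harmonic N) * ratioProd ν N s
      ≤ Real.exp ((1 - ν) * s * harmonic N) * ratioProd ν N s *
        (Real.exp ((1 - ν) * x) * ((1 + ν * x) / (1 + x))) :=
        le_mul_of_one_le_right (by positivity) h1
    _ = _ := by ring

theorem tendsto_rpow_mul_prod_Gamma_add_one {s : ℝ} (hs : 0 ≤ s) :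
    Tendsto (fun N : ℕ => (N : ℝ) ^ s * ∏ j ∈ Finset.range N, (1 + s / (j + 1))⁻¹) atTop
      (nhds (Real.Gamma (s + 1))) := by
  rcases hs.eq_or_lt with rfl | hs
  · simp
  rw [Real.Gamma_add_one hs.ne']
  refine ((Real.GammaSeq_tendsto_Gamma s).const_mul s).congr fun N => ?_
  have h : ∏ j ∈ Finset.range N, (1 + s / (j + 1))⁻¹ =
      N.factorial / ∏ j ∈ Finset.range N, (s + (j + 1 : ℕ)) := by
    rw [← Finset.prod_range_add_one_eq_factorial, Nat.cast_prod, ← Finset.prod_div_distrib]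
    refine Finset.prod_congr rfl fun j _ => ?_
    push_cast
    have : s + (j + 1) ≠ 0 := by positivity
    field_simp
    ring
  rw [Real.GammaSeq, Finset.prod_range_succ', h]
  have : ∏ j ∈ Finset.range N, (s + (j + 1 : ℕ)) ≠ 0 :=
    Finset.prod_ne_zero_iff.2 fun j _ => by positivity
  simp only [Nat.cast_zero, add_zero]
  field_simp

theorem tendsto_exp_harmonic_mul_ratioProd {ν : ℝ} (hν : 0 ≤ ν) {s : ℝ} (hs : 0 ≤ s) :
    Tendsto (fun N : ℕ => Real.exp ((1 - ν) * s * harmonic N) * ratioProd ν N s) atTop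
      (nhds (Real.exp ((1 - ν) * s * Real.eulerMascheroniConstant) *
        (Real.Gamma (s + 1) / Real.Gamma (ν * s + 1)))) := by
  have hνs : 0 ≤ ν * s := mul_nonneg hν hs
  have h1 := (tendsto_rpow_mul_prod_Gamma_add_one hs).div
    (tendsto_rpow_mul_prod_Gamma_add_one hνs) (Real.Gamma_pos_of_pos (by positivity)).ne'
  have h2 := (Real.continuous_exp.tendsto _).comp
    (Real.tendsto_harmonic_sub_log.const_mul ((1 - ν) * s))
  refine (h2.mul h1).congr' ?_
  filter_upwards [eventually_gt_atTop 0] with N hN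
  have hN' : (0 : ℝ) < N := by exact_mod_cast hN
  have h3 : Real.exp ((1 - ν) * s * harmonic N) =
      Real.exp ((1 - ν) * s * (harmonic N - Real.log N)) * ((N : ℝ) ^ s / (N : ℝ) ^ (ν * s)) := by
    rw [← Real.rpow_sub hN', Real.rpow_def_of_pos hN', ← Real.exp_add]
    ring_nf
  have h4 : ratioProd ν N s = (∏ j ∈ Finset.range N, (1 + s / (j + 1))⁻¹) /
      ∏ j ∈ Finset.range N, (1 + ν * s / (j + 1))⁻¹ := by
    rw [ratioProd, ← Finset.prod_div_distrib]
    refine Finset.prod_congr rfl fun j _ => ?_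
    rw [div_inv_eq_mul, div_eq_inv_mul]
  simp only [Function.comp, Pi.div_apply]
  rw [h3, h4, mul_div_mul_comm, ← mul_assoc]

theorem mittagLeffler_neg_bounds {ν : ℝ} (hν : ν ∈ Set.Ioo (0 : ℝ) 1) {z : ℝ} (hz : 0 ≤ z) :
    Real.exp (-(z / Real.Gamma (ν + 1))) ≤ mittagLeffler ν (-z) ∧ mittagLeffler ν (-z) ≤ 1 := by
  have hν' : ν ∈ Set.Icc (0 : ℝ) 1 := Set.Ioo_subset_Icc_self hν
  set y : ℝ := z * Real.exp (-((1 - ν) * Real.eulerMascheroniConstant)) with hy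
  have hy0 : 0 ≤ y := by positivity
  have hyz : y * Real.exp ((1 - ν) * Real.eulerMascheroniConstant) = z := by
    rw [hy, mul_assoc, ← Real.exp_add, neg_add_cancel, Real.exp_zero, mul_one]
  have hpow : ∀ (k : ℕ) (h : ℝ), Real.exp ((1 - ν) * k * h) = Real.exp ((1 - ν) * h) ^ k := by
    intro k h
    rw [← Real.exp_nat_mul]
    ring_nf
  have hterm : ∀ (k : ℕ) (u : ℝ), u ^ k / k.factorial *
      (Real.exp ((1 - ν) * k * Real.eulerMascheroniConstant) *
      (Real.Gamma (k + 1) / Real.Gamma (ν * k + 1))) =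
        (u * Real.exp ((1 - ν) * Real.eulerMascheroniConstant)) ^ k / Real.Gamma (ν * k + 1) := by
    intro k u
    have := Gamma_mul_natCast_add_one_pos hν.1 k
    rw [Real.Gamma_nat_eq_factorial, hpow, mul_pow]
    field_simp
  have hlim : Tendsto (fun N : ℕ => laplaceSeries (fun k => ratioProd ν N k)
      (y * Real.exp ((1 - ν) * harmonic N))) atTop (nhds (mittagLeffler ν (-z))) := by
    have h := tendsto_tsum_of_dominated_convergence (𝓕 := atTop)
      (f := fun (N k : ℕ) => (-y) ^ k / k.factorial *
        (Real.exp ((1 - ν) * k * harmonic N) * ratioProd ν N k))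
      (summable_mittagLeffler hν.1 z)
      (fun k => (tendsto_exp_harmonic_mul_ratioProd hν.1.le (Nat.cast_nonneg k)).const_mul _)
      (Eventually.of_forall fun N k => ?_)
    · simp only [hterm, neg_mul, hyz] at h
      refine h.congr fun N => tsum_congr fun k => ?_
      rw [hpow, ← neg_mul, mul_pow]
      ring
    · have h1 := ratioProd_nonneg hν.1.le N (Nat.cast_nonneg k)
      have h2 := (monotone_exp_harmonic_mul_ratioProd hν' (Nat.cast_nonneg k)).ge_of_tendsto
        (tendsto_exp_harmonic_mul_ratioProd hν.1.le (Nat.cast_nonneg k)) N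
      rw [norm_mul, norm_div, norm_pow, norm_neg, Real.norm_of_nonneg hy0, Real.norm_natCast,
        Real.norm_of_nonneg (by positivity), ← hyz, ← hterm]
      gcongr
  have hexp : Tendsto (fun N : ℕ => Real.exp (-ratioProd ν N 1 *
      (y * Real.exp ((1 - ν) * harmonic N)))) atTop
      (nhds (Real.exp (-(z / Real.Gamma (ν + 1))))) := by
    have h := ((tendsto_exp_harmonic_mul_ratioProd hν.1.le zero_le_one).const_mul y).neg
    have h' : -(y * (Real.exp ((1 - ν) * 1 * Real.eulerMascheroniConstant) *
        (Real.Gamma (1 + 1) / Real.Gamma (ν * 1 + 1)))) = -(z / Real.Gamma (ν + 1)) := by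
      rw [one_add_one_eq_two, Real.Gamma_two, mul_one, mul_one, ← mul_assoc, hyz, mul_one_div]
    rw [h'] at h
    refine (Real.continuous_exp.tendsto _).comp (h.congr fun N => ?_)
    rw [mul_one]
    ring
  have hb := fun N : ℕ => laplaceSeries_ratioProd_bounds hν' N
    (y * Real.exp ((1 - ν) * harmonic N)) (by positivity)
  exact ⟨le_of_tendsto_of_tendsto' hexp hlim fun N => (hb N).1,
    le_of_tendsto' hlim fun N => (hb N).2⟩

theorem abs_log_mittagLeffler_neg_le {ν : ℝ} (hν : ν ∈ Set.Ioo (0 : ℝ) 1) {z : ℝ} (hz : 0 ≤ z) :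
    |Real.log (mittagLeffler ν (-z))| ≤ z / Real.Gamma (ν + 1) := by
  obtain ⟨h1, h2⟩ := mittagLeffler_neg_bounds hν hz
  have h3 := Real.log_le_log (Real.exp_pos _) h1
  rw [Real.log_exp] at h3
  rw [abs_of_nonpos (Real.log_nonpos ((Real.exp_pos _).le.trans h1) h2)]
  linarith

theorem tendsto_mul_log_mittagLeffler_of_pos {ν : ℝ} (hν : ν ∈ Set.Ioo (0 : ℝ) 1) {ι : Type*}
    {l : Filter ι} {a x : ι → ℝ} (ha : ∀ᶠ t in l, 0 < a t) (ha0 : Tendsto a l (nhds 0)) {c : ℝ}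
    (hc : 0 < c) (hx : Tendsto (fun t => a t ^ ν * x t) l (nhds c)) :
    Tendsto (fun t => a t * Real.log (mittagLeffler ν (x t))) l (nhds (c ^ (1 / ν))) := by
  have hν0 := hν.1
  have hxpos : ∀ᶠ t in l, 0 < x t := by
    filter_upwards [ha, hx.eventually_const_lt hc] with t h1 h2
    exact pos_of_mul_pos_right h2 (by positivity)
  have haw : Tendsto (fun t => a t * x t ^ (1 / ν)) l (nhds (c ^ (1 / ν))) := by
    refine (hx.rpow_const (Or.inl hc.ne')).congr' ?_
    filter_upwards [ha, hxpos] with t h1 h2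
    rw [Real.mul_rpow (by positivity) h2.le, ← Real.rpow_mul h1.le, mul_one_div_cancel hν0.ne',
      Real.rpow_one]
  have hw : Tendsto (fun t => x t ^ (1 / ν)) l atTop := by
    have h := (tendsto_nhdsWithin_iff.2 ⟨ha0, ha⟩ : Tendsto a l (nhdsWithin 0 (Set.Ioi 0)))
    refine ((haw.pos_mul_atTop (by positivity) h.inv_tendsto_nhdsGT_zero)).congr' ?_
    filter_upwards [ha] with t h1
    simp only [Pi.inv_apply]
    field_simp
  have h := haw.mul ((tendsto_log_mittagLeffler_rpow_div hν).comp hw)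
  rw [mul_one] at h
  refine h.congr' ?_
  filter_upwards [hxpos] with t h1
  have h2 : (x t ^ (1 / ν)) ^ ν = x t := by
    rw [← Real.rpow_mul h1.le, one_div_mul_cancel hν0.ne', Real.rpow_one]
  have h3 : x t ^ (1 / ν) ≠ 0 := by positivity
  simp only [Function.comp, h2]
  field_simp

theorem tendsto_mul_log_mittagLeffler_of_neg {ν : ℝ} (hν : ν ∈ Set.Ioo (0 : ℝ) 1) {ι : Type*}
    {l : Filter ι} {a x : ι → ℝ} (ha : ∀ᶠ t in l, 0 < a t) (ha0 : Tendsto a l (nhds 0)) {c : ℝ}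
    (hc : c < 0) (hx : Tendsto (fun t => a t ^ ν * x t) l (nhds c)) :
    Tendsto (fun t => a t * Real.log (mittagLeffler ν (x t))) l (nhds 0) := by
  have h1 : Tendsto (fun t => a t ^ (1 - ν)) l (nhds 0) := by
    have h := ha0.rpow_const (p := 1 - ν) (Or.inr (sub_nonneg.2 hν.2.le))
    rwa [Real.zero_rpow (sub_ne_zero.2 hν.2.ne')] at h
  have h2 := ((h1.mul hx).neg.div_const (Real.Gamma (ν + 1)))
  rw [zero_mul, neg_zero, zero_div] at h2
  refine squeeze_zero_norm' ?_ h2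
  filter_upwards [ha, hx.eventually_lt_const hc] with t h3 h4
  have h5 : 0 ≤ -x t := by
    have := Real.rpow_pos_of_pos h3 ν
    nlinarith
  have h6 := abs_log_mittagLeffler_neg_le hν h5
  rw [neg_neg] at h6
  have h7 : a t ^ (1 - ν) * a t ^ ν = a t := by
    rw [← Real.rpow_add h3, sub_add_cancel, Real.rpow_one]
  rw [norm_mul, Real.norm_of_nonneg h3.le, Real.norm_eq_abs, ← mul_assoc, h7]
  calc a t * |Real.log (mittagLeffler ν (x t))| ≤ a t * (-x t / Real.Gamma (ν + 1)) := by gcongr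
    _ = _ := by ring

theorem tendsto_rpow_mul_timeChange {ν : ℝ} (hν : 0 < ν) {κ : ℝ → ℝ} {m : ℝ}
    (hκ : Tendsto (fun u : ℝ => κ u / u) (nhdsWithin 0 {(0 : ℝ)}ᶜ) (nhds m)) {a : ℝ → ℝ}
    (ha_pos : ∀ t : ℝ, 0 < t → 0 < a t) (hat : Tendsto (fun t : ℝ => t * a t) atTop atTop)
    {θ : ℝ} (hθ : θ ≠ 0) :
    Tendsto (fun t : ℝ => a t ^ ν * (κ (θ * (a t * t) ^ (-ν)) * t ^ ν)) atTop
      (nhds (m * θ)) := by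
  have hu : Tendsto (fun t : ℝ => θ * (a t * t) ^ (-ν)) atTop (nhdsWithin 0 {(0 : ℝ)}ᶜ) := by
    refine tendsto_nhdsWithin_iff.2 ⟨?_, ?_⟩
    · simpa only [mul_zero, Function.comp, mul_comm] using
        ((tendsto_rpow_neg_atTop hν).comp hat).const_mul θ
    · filter_upwards [eventually_gt_atTop 0] with t ht
      have := ha_pos t ht
      exact mul_ne_zero hθ (by positivity)
  refine ((hκ.comp hu).mul_const θ).congr' ?_
  filter_upwards [eventually_gt_atTop 0] with t ht
  have h1 := ha_pos t ht
  simp only [Function.comp]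
  rw [Real.rpow_neg (by positivity), Real.mul_rpow h1.le ht.le]
  field_simp

theorem mittagLeffler_MD_limit_two_time_changes (ν : ℝ) (hν : ν ∈ Set.Ioo (0 : ℝ) 1)
    (m₁ m₂ : ℝ) (hm₁ : 0 < m₁) (hm₂ : 0 < m₂)
    (κ₁ κ₂ : ℝ → ℝ) (hκ₁0 : κ₁ 0 = 0) (hκ₂0 : κ₂ 0 = 0)
    (hκ₁ : Tendsto (fun u : ℝ => κ₁ u / u) (nhdsWithin 0 {(0 : ℝ)}ᶜ) (nhds m₁))
    (hκ₂ : Tendsto (fun u : ℝ => κ₂ u / u) (nhdsWithin 0 {(0 : ℝ)}ᶜ) (nhds m₂))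
    (a : ℝ → ℝ) (ha_pos : ∀ t : ℝ, 0 < t → 0 < a t)
    (ha0 : Tendsto a atTop (nhds 0))
    (hat : Tendsto (fun t : ℝ => t * a t) atTop atTop)
    (θ : ℝ) :
    Tendsto (fun t : ℝ =>
        a t * (Real.log (mittagLeffler ν (κ₁ (θ * (a t * t) ^ (-ν)) * t ^ ν)) +
               Real.log (mittagLeffler ν (κ₂ (-θ * (a t * t) ^ (-ν)) * t ^ ν))))
      atTop (nhds (PsiMD ν m₁ m₂ θ)) := by
  have ha : ∀ᶠ t in atTop, 0 < a t := by
    filter_upwards [eventually_gt_atTop 0] with t ht using ha_pos t ht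
  simp only [mul_add]
  rcases lt_trichotomy θ 0 with hθ | rfl | hθ
  · have h1 := tendsto_mul_log_mittagLeffler_of_neg hν ha ha0 (mul_neg_of_pos_of_neg hm₁ hθ)
      (tendsto_rpow_mul_timeChange hν.1 hκ₁ ha_pos hat hθ.ne)
    have h2 := tendsto_mul_log_mittagLeffler_of_pos hν ha ha0 (mul_pos hm₂ (neg_pos.2 hθ))
      (tendsto_rpow_mul_timeChange hν.1 hκ₂ ha_pos hat (neg_ne_zero.2 hθ.ne))
    simpa [PsiMD, not_le.2 hθ] using h1.add h2
  · have h : Real.log (mittagLeffler ν 0) = 0 := by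
      simpa using abs_log_mittagLeffler_neg_le hν le_rfl
    simp [hκ₁0, hκ₂0, h, PsiMD, hν.1.ne']
  · have h1 := tendsto_mul_log_mittagLeffler_of_pos hν ha ha0 (mul_pos hm₁ hθ)
      (tendsto_rpow_mul_timeChange hν.1 hκ₁ ha_pos hat hθ.ne')
    have h2 := tendsto_mul_log_mittagLeffler_of_neg hν ha ha0
      (mul_neg_of_pos_of_neg hm₂ (neg_neg_of_pos hθ))
      (tendsto_rpow_mul_timeChange hν.1 hκ₂ ha_pos hat (neg_ne_zero.2 hθ.ne'))
    simpa [PsiMD, hθ.le] using h1.add h2
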